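/- Let 𝒜 be a semi-abelian category and let 0→K→X→Y→0 be a short exact sequence, with kernel k: K→X and regular epimorphism f: X→Y, such that f is a central extension. Let A be an abelian object and a: K→A any morphism. Then there exists a central extension p_a: Z_a→Y with kernel k_a: A→Z_a, together with a morphism ā: X→Z_a such that p_a∘ā = f and ā∘k = k_a∘a. -/

import Mathlib

open CategoryTheory CategoryTheory.Limits

universe v u

section Defs

variable {C : Type u} [Category.{v} C]

/-- A finitely complete category is protomodular if, for every commutative diagram of two
adjacent commutative squares in which the middle vertical morphism is a split epimorphism,
whenever the left-hand square and the outer rectangle are pullbacks, so is the right-hand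
square. -/
def Protomodular (C : Type u) [Category.{v} C] : Prop :=
  ∀ ⦃A B D A' B' D' : C⦄ (f : A ⟶ B) (g : B ⟶ D)
    (f' : A' ⟶ B') (g' : B' ⟶ D')
    (a : A ⟶ A') (b : B ⟶ B') (d : D ⟶ D'),
    g ≫ d = b ≫ g' →
    IsSplitEpi b →
    IsPullback f a b f' →
    IsPullback (f ≫ g) a d (f' ≫ g') →
    IsPullback g b d g'

variable [HasZeroMorphisms C] [HasFiniteLimits C]

/-- Two coterminal morphisms `k`, `k'` cooperate (commute in the sense of Huq) when there is
a morphism `φ : K ⨯ K' ⟶ X` restricting to `k` and `k'` along `(1,0)` and `(0,1)`. -/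
def Cooperate {K K' X : C} (k : K ⟶ X) (k' : K' ⟶ X) : Prop :=
  ∃ φ : K ⨯ K' ⟶ X, prod.lift (𝟙 K) 0 ≫ φ = k ∧ prod.lift 0 (𝟙 K') ≫ φ = k'

/-- A morphism is central in the sense of Huq when it cooperates with the identity. -/
def HuqCentral {K X : C} (k : K ⟶ X) : Prop :=
  Cooperate k (𝟙 X)

/-- An object is abelian when its identity cooperates with itself. -/
def IsAbelianObj (A : C) : Prop :=
  Cooperate (𝟙 A) (𝟙 A)

/-- `k` is a kernel of `f`. -/
def IsKernelOf {K X Y : C} (k : K ⟶ X) (f : X ⟶ Y) : Prop :=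
  ∃ w : k ≫ f = 0, Nonempty (IsLimit (KernelFork.ofι k w))

/-- A central extension is a regular epimorphism whose kernel is Huq-central. -/
def IsCentralExt {X Y : C} (f : X ⟶ Y) : Prop :=
  Nonempty (RegularEpi f) ∧ HuqCentral (kernel.ι f)

/-- A normal monomorphism: a morphism that is a kernel of some morphism. -/
def IsNormalMonoP {K X : C} (m : K ⟶ X) : Prop :=
  ∃ (Z : C) (g : X ⟶ Z), IsKernelOf m g

/-- `(p₁, p₂) : R ↣ X ⨯ X` is an internal equivalence relation. -/
structure IsEquivRelation {R X : C} (p₁ p₂ : R ⟶ X) : Prop where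
  mono : Mono (prod.lift p₁ p₂)
  refl : ∃ d : X ⟶ R, d ≫ p₁ = 𝟙 X ∧ d ≫ p₂ = 𝟙 X
  symm : ∃ s : R ⟶ R, s ≫ p₁ = p₂ ∧ s ≫ p₂ = p₁
  trans : ∃ t : pullback p₂ p₁ ⟶ R,
    t ≫ p₁ = pullback.fst p₂ p₁ ≫ p₁ ∧ t ≫ p₂ = pullback.snd p₂ p₁ ≫ p₂

end Defs

/-- A semi-abelian category: pointed, Barr-exact (regular with effective equivalence
relations), protomodular and with binary coproducts. -/
class SemiAbelian (C : Type u) [Category.{v} C] [HasZeroMorphisms C] [HasZeroObject C]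
    [HasFiniteLimits C] [HasBinaryCoproducts C] : Prop where
  /-- Every kernel pair has a coequalizer. -/
  hasCoeqOfKernelPair : ∀ {X Y : C} (f : X ⟶ Y),
    HasCoequalizer (pullback.fst f f) (pullback.snd f f)
  /-- Regular epimorphisms are stable under pullback. -/
  regEpiPullbackStable : ∀ {X Y Z : C} (f : X ⟶ Z) (g : Y ⟶ Z),
    Nonempty (RegularEpi g) → Nonempty (RegularEpi (pullback.fst f g))
  /-- Every internal equivalence relation is effective, i.e. a kernel pair. -/
  equivRelationEffective : ∀ {R X : C} (p₁ p₂ : R ⟶ X), IsEquivRelation p₁ p₂ →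
    ∃ (Y : C) (f : X ⟶ Y), IsKernelPair f p₁ p₂
  /-- The category is protomodular. -/
  protomodular : Protomodular C

attribute [local simp] prod.lift_fst prod.lift_snd prod.lift_fst_assoc prod.lift_snd_assoc
  prod.comp_lift prod.comp_lift_assoc pullback.lift_fst_assoc pullback.lift_snd_assoc
  pullback.lift_fst pullback.lift_snd coequalizer.π_desc

section Aux

open ZeroObject

variable {C : Type u} [Category.{v} C]

lemma exists_desc_of_regularEpi {X Y Z : C} {q : X ⟶ Y} (hq : Nonempty (RegularEpi q))
    (g : X ⟶ Z) (h : ∀ {T : C} (x y : T ⟶ X), x ≫ q = y ≫ q → x ≫ g = y ≫ g) :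
    ∃ d : Y ⟶ Z, q ≫ d = g := by
  obtain ⟨r⟩ := hq
  exact ⟨Cofork.IsColimit.desc r.isColimit g (h _ _ r.w), Cofork.IsColimit.π_desc r.isColimit⟩

/-- If `i ≫ p` is a regular epimorphism and `q ≫ p` factors through `i ≫ p` for some
epimorphism `q`, then `p` is the coequalizer of its kernel pair. -/
lemma regularEpi_of_comp [HasFiniteLimits C] {W X Y Z : C} {i : X ⟶ Z} {p : Z ⟶ Y}
    (h : Nonempty (RegularEpi (i ≫ p))) (q : W ⟶ Z) [Epi q] (t : W ⟶ X)
    (ht : q ≫ p = t ≫ i ≫ p) : Nonempty (RegularEpi p) := by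
  have hepi : Epi (i ≫ p) := h.some.epi
  have hp : Epi p := epi_of_epi i p
  refine ⟨⟨pullback p p, pullback.fst p p, pullback.snd p p, pullback.condition, ?_⟩⟩
  refine Cofork.IsColimit.mk' _ fun s ↦ ?_
  have hs : ∀ {T : C} (x y : T ⟶ Z), x ≫ p = y ≫ p → x ≫ s.π = y ≫ s.π := by
    intro T x y hxy
    have := pullback.lift x y hxy ≫= s.condition
    simpa using this
  have hd := exists_desc_of_regularEpi h (i ≫ s.π) (by
    intro T x y hxy
    simpa using hs (x ≫ i) (y ≫ i) (by simpa using hxy))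
  have hfac : p ≫ hd.choose = s.π := by
    have h₁ := hd.choose_spec
    have h₂ := hs q (t ≫ i) (by simpa using ht)
    rw [Category.assoc] at h₁ h₂
    rw [← cancel_epi q, reassoc_of% ht, h₁, h₂]
  exact ⟨hd.choose, hfac, fun {m} hm ↦ by rw [← cancel_epi p, hfac]; exact hm⟩

variable [HasZeroMorphisms C]

lemma IsKernelOf.mono {K X Y : C} {k : K ⟶ X} {f : X ⟶ Y} (hk : IsKernelOf k f) : Mono k := by
  obtain ⟨w, ⟨h⟩⟩ := hk
  exact ⟨fun x y hxy ↦ Fork.IsLimit.hom_ext h hxy⟩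

lemma IsKernelOf.exists_lift {K X Y T : C} {k : K ⟶ X} {f : X ⟶ Y} (hk : IsKernelOf k f)
    (t : T ⟶ X) (ht : t ≫ f = 0) : ∃ l : T ⟶ K, l ≫ k = t := by
  obtain ⟨w, ⟨h⟩⟩ := hk
  exact ⟨h.lift (KernelFork.ofι t ht), h.fac (KernelFork.ofι t ht) WalkingParallelPair.zero⟩

lemma isKernelOf_of_exists_lift {K X Y : C} {k : K ⟶ X} {f : X ⟶ Y} [Mono k] (w : k ≫ f = 0)
    (h : ∀ {T : C} (t : T ⟶ X), t ≫ f = 0 → ∃ l : T ⟶ K, l ≫ k = t) : IsKernelOf k f := by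
  refine ⟨w, ⟨KernelFork.IsLimit.ofι k w (fun t ht ↦ (h t ht).choose)
    (fun t ht ↦ (h t ht).choose_spec) fun t ht m hm ↦ ?_⟩⟩
  rw [← cancel_mono k, hm, (h t ht).choose_spec]

lemma IsKernelOf.isPullback [HasZeroObject C] {K X Y : C} {k : K ⟶ X} {f : X ⟶ Y}
    (hk : IsKernelOf k f) :
    IsPullback k (0 : K ⟶ (0 : C)) f (0 : (0 : C) ⟶ Y) := by
  have := hk.mono
  refine ⟨⟨by rw [hk.choose, zero_comp]⟩, ⟨PullbackCone.IsLimit.mk _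
    (fun s ↦ (hk.exists_lift s.fst (by simp [s.condition])).choose)
    (fun s ↦ (hk.exists_lift s.fst (by simp [s.condition])).choose_spec)
    (fun s ↦ by ext) fun s m h₁ h₂ ↦ ?_⟩⟩
  rw [← cancel_mono k, h₁, (hk.exists_lift s.fst (by simp [s.condition])).choose_spec]

variable [HasFiniteLimits C]

lemma isKernelOf_prod_snd (K X : C) :
    IsKernelOf (prod.lift (𝟙 K) (0 : K ⟶ X)) (prod.snd : K ⨯ X ⟶ X) := by
  have : Mono (prod.lift (𝟙 K) (0 : K ⟶ X)) :=
    mono_of_mono_fac (prod.lift_fst (𝟙 K) (0 : K ⟶ X))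
  refine isKernelOf_of_exists_lift (by simp) fun t ht ↦ ⟨t ≫ prod.fst, ?_⟩
  ext <;> simp [ht]

lemma HuqCentral.comp {K L X : C} {k : K ⟶ X} (hk : HuqCentral k) (i : L ⟶ K) :
    HuqCentral (i ≫ k) := by
  obtain ⟨φ, h₁, h₂⟩ := hk
  refine ⟨prod.map i (𝟙 X) ≫ φ, ?_, ?_⟩
  · rw [← h₁, ← Category.assoc, ← Category.assoc]
    congr 1
    ext <;> simp
  · rw [← Category.assoc]
    convert h₂ using 2
    ext <;> simp

lemma lift_zero_comp {K X Z T : C} {φ : K ⨯ X ⟶ Z} {k : K ⟶ Z}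
    (h : prod.lift (𝟙 K) 0 ≫ φ = k) (x : T ⟶ K) : prod.lift x 0 ≫ φ = x ≫ k := by
  rw [← h, ← Category.assoc]
  simp

lemma zero_lift_comp {K X Z T : C} {φ : K ⨯ X ⟶ Z} {k : X ⟶ Z}
    (h : prod.lift 0 (𝟙 X) ≫ φ = k) (x : T ⟶ X) : prod.lift 0 x ≫ φ = x ≫ k := by
  rw [← h, ← Category.assoc]
  simp

variable [HasZeroObject C]

/-- In a pointed protomodular category, the product inclusions are jointly epimorphic. -/
lemma Protomodular.prod_hom_ext (hC : Protomodular C) {K X T : C} {u w : K ⨯ X ⟶ T}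
    (h₁ : prod.lift (𝟙 K) 0 ≫ u = prod.lift (𝟙 K) 0 ≫ w)
    (h₂ : prod.lift 0 (𝟙 X) ≫ u = prod.lift 0 (𝟙 X) ≫ w) : u = w := by
  let e := equalizer.ι u w
  let s₁ : K ⟶ equalizer u w := equalizer.lift _ h₁
  let s₂ : X ⟶ equalizer u w := equalizer.lift _ h₂
  have hs₁ : s₁ ≫ e = prod.lift (𝟙 K) 0 := equalizer.lift_ι _ _
  have hs₂ : s₂ ≫ e = prod.lift 0 (𝟙 X) := equalizer.lift_ι _ _
  have hk : IsKernelOf s₁ (e ≫ prod.snd) := by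
    have : Mono s₁ := mono_of_mono_fac (show s₁ ≫ e ≫ prod.fst = 𝟙 K by
      rw [reassoc_of% hs₁, prod.lift_fst])
    refine isKernelOf_of_exists_lift (by rw [reassoc_of% hs₁, prod.lift_snd])
      fun t ht ↦ ⟨t ≫ e ≫ prod.fst, ?_⟩
    rw [← cancel_mono e]
    ext <;> simp [hs₁, ht]
  have hpb : IsPullback e (e ≫ prod.snd) prod.snd (𝟙 X) :=
    hC s₁ e (0 : (0 : C) ⟶ X) (𝟙 X) 0 (e ≫ prod.snd) prod.snd (by simp)
      ⟨⟨⟨s₂, by rw [reassoc_of% hs₂, prod.lift_snd]⟩⟩⟩ hk.isPullback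
      (by simpa [hs₁] using (isKernelOf_prod_snd K X).isPullback)
  have : IsIso e := hpb.isIso_fst_of_isIso
  exact (cancel_epi e).1 (equalizer.condition u w)

/-- A cooperator between the kernel of `f` and the identity exhibits `X` as a torsor over `f`. -/
lemma Protomodular.isKernelPair (hC : Protomodular C) {K X Y : C} {k : K ⟶ X} {f : X ⟶ Y}
    (hk : IsKernelOf k f) {φ : K ⨯ X ⟶ X} (h₁ : prod.lift (𝟙 K) 0 ≫ φ = k)
    (h₂ : prod.lift 0 (𝟙 X) ≫ φ = 𝟙 X) : IsKernelPair f φ prod.snd := by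
  refine hC (prod.lift (𝟙 K) 0) φ (0 : (0 : C) ⟶ X) f 0 prod.snd f ?_
    ⟨⟨⟨prod.lift 0 (𝟙 X), by simp⟩⟩⟩ (isKernelOf_prod_snd K X).isPullback
    (by simpa [h₁] using hk.isPullback)
  apply hC.prod_hom_ext
  · rw [reassoc_of% h₁, hk.choose]; simp
  · rw [reassoc_of% h₂]; simp

/-- A cooperator with the identity is an action of any unital multiplication. -/
lemma Protomodular.act_act (hC : Protomodular C) {K X T : C} {m : K ⨯ K ⟶ K}
    (hm₁ : prod.lift (𝟙 K) 0 ≫ m = 𝟙 K) (hm₂ : prod.lift 0 (𝟙 K) ≫ m = 𝟙 K) {φ : K ⨯ X ⟶ X}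
    (h₂ : prod.lift 0 (𝟙 X) ≫ φ = 𝟙 X) (x y : T ⟶ K)
    (z : T ⟶ X) :
    prod.lift x (prod.lift y z ≫ φ) ≫ φ = prod.lift (prod.lift x y ≫ m) z ≫ φ := by
  have key : (prod.lift prod.fst (prod.snd ≫ φ) ≫ φ : K ⨯ (K ⨯ X) ⟶ X) =
      prod.lift (prod.lift prod.fst (prod.snd ≫ prod.fst) ≫ m) (prod.snd ≫ prod.snd) ≫ φ := by
    apply hC.prod_hom_ext
    · simp [← Category.assoc, prod.comp_lift, hm₁]
    · simp only [← Category.assoc, prod.comp_lift, prod.lift_fst, prod.lift_snd, Category.id_comp,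
        zero_lift_comp hm₂, zero_lift_comp h₂, Category.comp_id]
      simp
  have := prod.lift x (prod.lift y z) ≫= key
  simpa [← Category.assoc, prod.comp_lift] using this

lemma Protomodular.comm (hC : Protomodular C) {A T : C} {m : A ⨯ A ⟶ A}
    (h₁ : prod.lift (𝟙 A) 0 ≫ m = 𝟙 A) (h₂ : prod.lift 0 (𝟙 A) ≫ m = 𝟙 A) (x y : T ⟶ A) :
    prod.lift x y ≫ m = prod.lift y x ≫ m := by
  have key : m = prod.lift prod.snd prod.fst ≫ m := by
    apply hC.prod_hom_ext <;> simp [← Category.assoc, prod.comp_lift, h₁, h₂]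
  have := prod.lift x y ≫= key
  simpa [← Category.assoc, prod.comp_lift] using this

lemma Protomodular.map_mul (hC : Protomodular C) {K A T : C} {m : K ⨯ K ⟶ K} {n : A ⨯ A ⟶ A}
    (hm₁ : prod.lift (𝟙 K) 0 ≫ m = 𝟙 K) (hm₂ : prod.lift 0 (𝟙 K) ≫ m = 𝟙 K)
    (hn₁ : prod.lift (𝟙 A) 0 ≫ n = 𝟙 A) (hn₂ : prod.lift 0 (𝟙 A) ≫ n = 𝟙 A)
    (a : K ⟶ A) (x y : T ⟶ K) :
    prod.lift x y ≫ m ≫ a = prod.lift (x ≫ a) (y ≫ a) ≫ n := by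
  have key : m ≫ a = prod.lift (prod.fst ≫ a) (prod.snd ≫ a) ≫ n := by
    apply hC.prod_hom_ext
    · simp only [← Category.assoc, prod.comp_lift, hm₁]
      simp [lift_zero_comp hn₁]
    · simp only [← Category.assoc, prod.comp_lift, hm₂]
      simp [zero_lift_comp hn₂]
  have := prod.lift x y ≫= key
  simpa [← Category.assoc, prod.comp_lift] using this

/-- In an exact category, every internal equivalence relation is the kernel pair of a
regular epimorphism. -/
lemma SemiAbelian.exists_regularEpi [HasBinaryCoproducts C] [SemiAbelian C] {R X : C}
    {p₁ p₂ : R ⟶ X} (h : IsEquivRelation p₁ p₂) :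
    ∃ (Z : C) (q : X ⟶ Z), Nonempty (RegularEpi q) ∧ IsKernelPair q p₁ p₂ := by
  obtain ⟨Y, f, hf⟩ := SemiAbelian.equivRelationEffective p₁ p₂ h
  have := SemiAbelian.hasCoeqOfKernelPair f
  have hw : p₁ ≫ coequalizer.π (pullback.fst f f) (pullback.snd f f) =
      p₂ ≫ coequalizer.π (pullback.fst f f) (pullback.snd f f) := by
    have := pullback.lift p₁ p₂ hf.w ≫=
      coequalizer.condition (pullback.fst f f) (pullback.snd f f)
    simpa using this
  refine ⟨_, coequalizer.π (pullback.fst f f) (pullback.snd f f),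
    ⟨⟨_, _, _, coequalizer.condition _ _, coequalizerIsCoequalizer _ _⟩⟩,
    IsKernelPair.cancel_right hw (f₂ := coequalizer.desc f pullback.condition) ?_⟩
  simpa using hf

lemma isEquivRelation_of_action (hC : Protomodular C) {K X Y A : C} {k : K ⟶ X} {f : X ⟶ Y}
    (hk : IsKernelOf k f) {φ : K ⨯ X ⟶ X} (h₁ : prod.lift (𝟙 K) 0 ≫ φ = k)
    (h₂ : prod.lift 0 (𝟙 X) ≫ φ = 𝟙 X) {n : A ⨯ A ⟶ A}
    (hn₁ : prod.lift (𝟙 A) 0 ≫ n = 𝟙 A) (hn₂ : prod.lift 0 (𝟙 A) ≫ n = 𝟙 A) (a : K ⟶ A) :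
    IsEquivRelation (R := K ⨯ (X ⨯ A))
      (prod.lift (prod.lift prod.fst (prod.snd ≫ prod.fst) ≫ φ) (prod.snd ≫ prod.snd))
      (prod.lift (prod.snd ≫ prod.fst) (prod.lift (prod.fst ≫ a) (prod.snd ≫ prod.snd) ≫ n)) := by
  have hpair := hC.isKernelPair hk h₁ h₂
  have hmono := hk.mono
  have hφf : φ ≫ f = prod.snd ≫ f := hpair.w
  have hfree : ∀ {T : C} (x y : T ⟶ K) (z : T ⟶ X),
      prod.lift x z ≫ φ = prod.lift y z ≫ φ → x = y := by
    intro T x y z h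
    simpa using congrArg (· ≫ prod.fst) (hpair.hom_ext h (by simp))
  obtain ⟨m, hm⟩ := hk.exists_lift (prod.map (𝟙 K) k ≫ φ) (by
    rw [Category.assoc, hφf, prod.map_snd_assoc, hk.choose, comp_zero])
  have hm₁ : prod.lift (𝟙 K) 0 ≫ m = 𝟙 K := by
    rw [← cancel_mono k, Category.assoc, hm, ← Category.assoc, prod.lift_map]
    simp [h₁]
  have hm₂ : prod.lift 0 (𝟙 K) ≫ m = 𝟙 K := by
    rw [← cancel_mono k, Category.assoc, hm, ← Category.assoc, prod.lift_map]
    simp [zero_lift_comp h₂]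
  -- inverses in `K`
  obtain ⟨ν, hν⟩ : ∃ ν : K ⟶ K, prod.lift ν (𝟙 K) ≫ m = 0 := by
    have hw : (0 : K ⟶ X) ≫ f = k ≫ f := by rw [hk.choose, zero_comp]
    refine ⟨hpair.lift 0 k hw ≫ prod.fst, ?_⟩
    rw [← cancel_mono k, Category.assoc, hm, ← Category.assoc, prod.lift_map, zero_comp]
    convert hpair.lift_fst 0 k hw using 2
    ext
    · simp
    · simp
  refine ⟨⟨fun u w h ↦ ?_⟩, ⟨prod.lift 0 (𝟙 _), ?_, ?_⟩, ⟨prod.lift (prod.fst ≫ ν)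
    (prod.lift (prod.lift prod.fst (prod.snd ≫ prod.fst) ≫ φ)
      (prod.lift (prod.fst ≫ a) (prod.snd ≫ prod.snd) ≫ n)), ?_, ?_⟩, ?_⟩
  · have e₁ := congrArg (· ≫ prod.fst ≫ prod.fst) h
    have e₂ := congrArg (· ≫ prod.fst ≫ prod.snd) h
    have e₃ := congrArg (· ≫ prod.snd ≫ prod.fst) h
    simp only [Category.assoc, prod.lift_fst, prod.lift_snd, prod.lift_fst_assoc,
      prod.lift_snd_assoc, prod.comp_lift_assoc] at e₁ e₂ e₃
    rw [e₃] at e₁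
    ext
    · exact hfree _ _ _ e₁
    · simpa using e₃
    · simpa using e₂
  · ext <;> simp [zero_lift_comp h₂]
  · ext <;> simp [zero_lift_comp hn₂]
  · have : prod.lift (prod.fst ≫ ν) prod.fst ≫ m = (0 : K ⨯ (X ⨯ A) ⟶ K) := by
      rw [← comp_zero (f := (prod.fst : K ⨯ (X ⨯ A) ⟶ K)), ← hν]
      simp
    ext
    · simp [hC.act_act hm₁ hm₂ h₂, this, zero_lift_comp h₂]
    · simp
  · have : prod.lift (prod.fst ≫ ν ≫ a) (prod.fst ≫ a) ≫ n = (0 : K ⨯ (X ⨯ A) ⟶ A) := by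
      rw [← Category.assoc prod.fst, ← hC.map_mul hm₁ hm₂ hn₁ hn₂,
        ← comp_zero (f := (prod.fst : K ⨯ (X ⨯ A) ⟶ K)), ← zero_comp (f := a), ← hν]
      simp
    ext
    · simp
    · simp [-prod.lift_fst_comp_snd_comp, hC.act_act hn₁ hn₂ hn₂, this, zero_lift_comp hn₂]
  · let p₁ : K ⨯ (X ⨯ A) ⟶ X ⨯ A :=
      prod.lift (prod.lift prod.fst (prod.snd ≫ prod.fst) ≫ φ) (prod.snd ≫ prod.snd)
    let p₂ : K ⨯ (X ⨯ A) ⟶ X ⨯ A :=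
      prod.lift (prod.snd ≫ prod.fst) (prod.lift (prod.fst ≫ a) (prod.snd ≫ prod.snd) ≫ n)
    change ∃ t : pullback p₂ p₁ ⟶ _, t ≫ p₁ = pullback.fst p₂ p₁ ≫ p₁ ∧
      t ≫ p₂ = pullback.snd p₂ p₁ ≫ p₂
    have hx := congrArg (· ≫ prod.fst) (pullback.condition (f := p₂) (g := p₁))
    have hα := congrArg (· ≫ prod.snd) (pullback.condition (f := p₂) (g := p₁))
    generalize pullback.fst p₂ p₁ = y at hx hα ⊢
    generalize pullback.snd p₂ p₁ = z at hx hα ⊢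
    simp only [p₁, p₂, Category.assoc, prod.lift_fst, prod.lift_snd, prod.comp_lift_assoc]
      at hx hα
    refine ⟨prod.lift (prod.lift (y ≫ prod.fst) (z ≫ prod.fst) ≫ m)
      (prod.lift (z ≫ prod.snd ≫ prod.fst) (y ≫ prod.snd ≫ prod.snd)), ?_, ?_⟩
    · ext
      · simp [p₁, ← hC.act_act hm₁ hm₂ h₂, hx]
      · simp [p₁]
    · ext
      · simp [p₂]
      · simp [-prod.lift_fst_comp_snd_comp, p₂, ← hα, hC.map_mul hm₁ hm₂ hn₁ hn₂,
          hC.act_act hn₁ hn₂ hn₂,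
          hC.comm hn₁ hn₂ (y ≫ prod.fst ≫ a) (z ≫ prod.fst ≫ a)]

end Aux

/-- Given a central extension `f : X ⟶ Y` with kernel `k : K ⟶ X`, an abelian object `A`
and any morphism `a : K ⟶ A`, there is a central extension of `Y` by `A`
making the diagram commutative. -/
theorem statement8 {C : Type u} [Category.{v} C] [HasZeroMorphisms C] [HasZeroObject C]
    [HasFiniteLimits C] [HasBinaryCoproducts C] [SemiAbelian C]
    {K X Y : C} (k : K ⟶ X) (f : X ⟶ Y)
    (hk : IsKernelOf k f) (hf : IsCentralExt f)
    {A : C} (hA : IsAbelianObj A) (a : K ⟶ A) :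
    ∃ (Za : C) (pa : Za ⟶ Y) (ka : A ⟶ Za) (abar : X ⟶ Za),
      IsCentralExt pa ∧ IsKernelOf ka pa ∧ abar ≫ pa = f ∧ k ≫ abar = a ≫ ka := by
  have hC : Protomodular C := SemiAbelian.protomodular
  obtain ⟨l, hl⟩ := (show IsKernelOf (kernel.ι f) f from
    ⟨kernel.condition f, ⟨kernelIsKernel f⟩⟩).exists_lift k hk.choose
  obtain ⟨φ, h₁, h₂⟩ := hf.2.comp l
  rw [hl] at h₁
  obtain ⟨n, hn₁, hn₂⟩ := hA
  have hmono := hk.mono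
  have hpair := hC.isKernelPair hk h₁ h₂
  obtain ⟨Z, q, hq, hqp⟩ :=
    SemiAbelian.exists_regularEpi (isEquivRelation_of_action hC hk h₁ h₂ hn₁ hn₂ a)
  have hqepi : Epi q := hq.some.epi
  -- the defining relation `(κ · x, α) ∼ (x, a κ + α)` of the quotient `q`, and its effectiveness
  have hrel : ∀ {T : C} (κ : T ⟶ K) (x : T ⟶ X) (α : T ⟶ A),
      prod.lift (prod.lift κ x ≫ φ) α ≫ q = prod.lift x (prod.lift (κ ≫ a) α ≫ n) ≫ q := by
    intro T κ x α
    simpa [-prod.lift_fst_comp_snd_comp] using prod.lift κ (prod.lift x α) ≫= hqp.w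
  have heff : ∀ {T : C} (x y : T ⟶ X ⨯ A), x ≫ q = y ≫ q → ∃ κ : T ⟶ K,
      x ≫ prod.fst = prod.lift κ (y ≫ prod.fst) ≫ φ ∧
        y ≫ prod.snd = prod.lift (κ ≫ a) (x ≫ prod.snd) ≫ n := by
    intro T x y hxy
    have e₁ := hqp.lift_fst x y hxy
    have e₂ := hqp.lift_snd x y hxy
    generalize hqp.lift x y hxy = r at e₁ e₂
    subst e₁ e₂
    exact ⟨r ≫ prod.fst, by simp, by simp [-prod.lift_fst_comp_snd_comp]⟩
  obtain ⟨p, hp⟩ := exists_desc_of_regularEpi hq (prod.fst ≫ f) (by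
    intro T x y hxy
    obtain ⟨κ, hκ, -⟩ := heff x y hxy
    rw [reassoc_of% hκ, hpair.w]
    simp)
  have habar : (prod.lift (𝟙 X) (0 : X ⟶ A) ≫ q) ≫ p = f := by simp [hp]
  have hkq : k ≫ prod.lift (𝟙 X) (0 : X ⟶ A) ≫ q = a ≫ prod.lift 0 (𝟙 A) ≫ q := by
    have := hrel (𝟙 K) 0 0
    rw [lift_zero_comp h₁, lift_zero_comp hn₁] at this
    simpa using this
  have hpreg : Nonempty (RegularEpi p) := by
    refine regularEpi_of_comp (i := prod.lift (𝟙 X) (0 : X ⟶ A) ≫ q) ?_ q prod.fst ?_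
    · rw [habar]; exact hf.1
    · rw [habar, hp]
  have hkamono : Mono (prod.lift (0 : A ⟶ X) (𝟙 A) ≫ q) := by
    refine ⟨fun α β h ↦ ?_⟩
    obtain ⟨κ, hκ, hα⟩ := heff (prod.lift 0 α) (prod.lift 0 β) (by simpa using h)
    have : κ = 0 := by
      simp only [prod.lift_fst, lift_zero_comp h₁] at hκ
      rw [← cancel_mono k, ← hκ, zero_comp]
    simpa [this, zero_lift_comp hn₂] using hα.symm
  have hker : IsKernelOf (prod.lift (0 : A ⟶ X) (𝟙 A) ≫ q) p := by
    refine isKernelOf_of_exists_lift (by simp [hp]) fun {T} t ht ↦ ?_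
    have hr := SemiAbelian.regEpiPullbackStable t q hq
    have hrepi := hr.some.epi
    have hsq := pullback.condition (f := t) (g := q)
    obtain ⟨κ, hκ⟩ := hk.exists_lift (pullback.snd t q ≫ prod.fst) (by
      rw [Category.assoc, ← hp, ← reassoc_of% hsq, ht, comp_zero])
    have hg : (prod.lift (κ ≫ a) (pullback.snd t q ≫ prod.snd) ≫ n) ≫
        prod.lift (0 : A ⟶ X) (𝟙 A) ≫ q = pullback.fst t q ≫ t := by
      have := hrel κ 0 (pullback.snd t q ≫ prod.snd)
      rw [lift_zero_comp h₁, hκ, ← prod.comp_lift, prod.lift_fst_snd, Category.comp_id] at this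
      rw [hsq, this]
      simp
    obtain ⟨d, hd⟩ := exists_desc_of_regularEpi hr
      (prod.lift (κ ≫ a) (pullback.snd t q ≫ prod.snd) ≫ n) (by
        intro S x y hxy
        rw [← cancel_mono (prod.lift (0 : A ⟶ X) (𝟙 A) ≫ q), Category.assoc, Category.assoc y, hg,
          reassoc_of% hxy])
    exact ⟨d, by rw [← cancel_epi (pullback.fst t q), reassoc_of% hd, ← hg, Category.assoc]⟩
  have hcentral : HuqCentral (prod.lift (0 : A ⟶ X) (𝟙 A) ≫ q) := by
    let r := pullback.fst (prod.snd : A ⨯ Z ⟶ Z) q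
    let s := pullback.snd (prod.snd : A ⨯ Z ⟶ Z) q
    have hrs : r ≫ prod.snd = s ≫ q := pullback.condition
    obtain ⟨ψ, hψ⟩ := exists_desc_of_regularEpi
      (SemiAbelian.regEpiPullbackStable (prod.snd : A ⨯ Z ⟶ Z) q hq)
      (prod.lift (s ≫ prod.fst) (prod.lift (s ≫ prod.snd) (r ≫ prod.fst) ≫ n) ≫ q) (by
        intro T x y hxy
        change x ≫ r = y ≫ r at hxy
        obtain ⟨κ, hx, hα⟩ := heff (x ≫ s) (y ≫ s) (by
          simp only [Category.assoc, ← hrs, reassoc_of% hxy])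
        simp only [Category.assoc] at hx hα
        simp only [prod.comp_lift_assoc, hx, hrel,
          hC.act_act hn₁ hn₂ hn₂, ← hα, reassoc_of% hxy])
    have hψ' : ∀ {T : C} (β : T ⟶ A) (x : T ⟶ X ⨯ A), prod.lift β (x ≫ q) ≫ ψ =
        prod.lift (x ≫ prod.fst) (prod.lift (x ≫ prod.snd) β ≫ n) ≫ q := by
      intro T β x
      have e₁ : pullback.lift (prod.lift β (x ≫ q)) x (by simp) ≫ r = _ := pullback.lift_fst _ _ _
      have e₂ : pullback.lift (prod.lift β (x ≫ q)) x (by simp) ≫ s = _ := pullback.lift_snd _ _ _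
      have := pullback.lift (prod.lift β (x ≫ q)) x (by simp) ≫= hψ
      change _ ≫ r ≫ ψ = _ at this
      rw [reassoc_of% e₁] at this
      rw [this]
      simp [reassoc_of% e₁, reassoc_of% e₂]
    refine ⟨ψ, ?_, ?_⟩
    · simpa [zero_lift_comp hn₂] using hψ' (𝟙 A) 0
    · rw [← cancel_epi q]
      simpa [lift_zero_comp hn₁, ← prod.comp_lift] using hψ' 0 (𝟙 _)
  obtain ⟨i, hi⟩ := hker.exists_lift (kernel.ι p) (kernel.condition p)
  exact ⟨Z, p, prod.lift 0 (𝟙 A) ≫ q, prod.lift (𝟙 X) 0 ≫ q,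
    ⟨hpreg, hi ▸ hcentral.comp i⟩, hker, habar, hkq⟩
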